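/- arXiv:2401.17952 — 5 statements merged into one kernel-verified Lean document; each statement's English description precedes it below -/
import Mathlib

section
/- Assume the report f_A hides no negatives, let k ≥ 1 be an integer, δ ∈ (0,1), let N⁺ = |{x ∈ R : f(x) = +1}| ≥ 1 and err* = err(t*) = min over T of err. Define the (random) revealed responsive set B⁺ as follows: if Y_i = 1 for some i with f(x₍ᵢ₎) = +1, then B⁺ = {x ∈ R : f(x) = +1}; otherwise B⁺ = {x ∈ R : f(x) = +1 and (f_A(x) = +1 or x ≥ t*_A)}. Then with probability at least 1 − δ one has |B⁺| ≥ N⁺ − (err* + k − 1); that is, the recall |B⁺|/N⁺ is at least 1 − (err* + k − 1)/N⁺. -/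
open MeasureTheory ProbabilityTheory

/-- The error of the threshold classifier at `t` on the instance `(R, f)`:
points `x ≥ t` are predicted `+1`, points `x < t` are predicted `-1`. -/
noncomputable def errOf (R : Finset ℝ) (f : ℝ → ℤ) (t : ℝ) : ℕ :=
  (R.filter (fun x => t ≤ x ∧ f x = -1)).card +
    (R.filter (fun x => x < t ∧ f x = 1)).card

/-- If each `Y i` with `i ∈ S` is `true` with probability at least `min 1 y`, independently,
then all of them are `false` with probability at most `exp (-|S| y)`. -/
theorem measure_iInter_eq_false_le {ι Ω : Type*} [MeasurableSpace Ω] {μ : Measure Ω}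
    [IsProbabilityMeasure μ] {Y : ι → Ω → Bool} (hmeas : ∀ i, Measurable (Y i))
    (hindep : iIndepFun Y μ) (S : Finset ι) {y : ℝ} (hy : 0 ≤ y)
    (hS : ∀ i ∈ S, ENNReal.ofReal (min 1 y) ≤ μ {ω | Y i ω = true}) :
    μ (⋂ i ∈ S, {ω | Y i ω = false}) ≤ ENNReal.ofReal (Real.exp (-(S.card * y))) := by
  have hfactor : ∀ i ∈ S, μ {ω | Y i ω = false} ≤ ENNReal.ofReal (Real.exp (-y)) := by
    intro i hi
    have hcompl : {ω | Y i ω = false} = {ω | Y i ω = true}ᶜ := by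
      ext ω; simp
    have htrue : MeasurableSet {ω | Y i ω = true} := hmeas i (measurableSet_singleton true)
    rw [hcompl, prob_compl_eq_one_sub htrue]
    calc 1 - μ {ω | Y i ω = true} ≤ 1 - ENNReal.ofReal (min 1 y) :=
          tsub_le_tsub_left (hS i hi) 1
      _ = ENNReal.ofReal (1 - min 1 y) := by
          rw [ENNReal.ofReal_sub _ (le_min zero_le_one hy), ENNReal.ofReal_one]
      _ ≤ ENNReal.ofReal (Real.exp (-y)) := by
          apply ENNReal.ofReal_le_ofReal
          rcases min_cases 1 y with h | h
          · rw [h.1, sub_self]; positivity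
          · rw [h.1]; linarith [Real.add_one_le_exp (-y)]
  have hprod := hindep.measure_inter_preimage_eq_mul S (sets := fun _ => {false})
    (fun i _ => measurableSet_singleton false)
  calc μ (⋂ i ∈ S, {ω | Y i ω = false}) = ∏ i ∈ S, μ {ω | Y i ω = false} := hprod
    _ ≤ ∏ _i ∈ S, ENNReal.ofReal (Real.exp (-y)) := Finset.prod_le_prod' hfactor
    _ = ENNReal.ofReal (Real.exp (-(S.card * y))) := by
        rw [Finset.prod_const, ← ENNReal.ofReal_pow (Real.exp_pos _).le, ← Real.exp_nat_mul,
          mul_neg]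

/-- The positives missing from the undetected revealed set are those hidden below `tA`. -/
theorem card_positives_eq_add_card_hidden (R : Finset ℝ) (f fA : ℝ → ℤ)
    (hfA : ∀ x ∈ R, fA x = 1 ∨ fA x = -1) (tA : ℝ) :
    (R.filter (fun x => f x = 1)).card =
      (R.filter (fun x => f x = 1 ∧ (fA x = 1 ∨ tA ≤ x))).card +
        (R.filter (fun x => x < tA ∧ fA x = -1 ∧ f x = 1)).card := by
  rw [← Finset.card_union_of_disjoint]
  · congr 1
    ext x
    simp only [Finset.mem_filter, Finset.mem_union]
    have := hfA x
    grind
  · rw [Finset.disjoint_filter]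
    grind

/-- Hidden positives below `tA` lie above `t`, or are counted by the error at `t`. -/
theorem card_hidden_le_errOf_add (R : Finset ℝ) (f fA : ℝ → ℤ) (t tA : ℝ) :
    (R.filter (fun x => x < tA ∧ fA x = -1 ∧ f x = 1)).card ≤
      errOf R f t +
        (R.filter (fun x => t ≤ x ∧ x < tA ∧ fA x = -1 ∧ f x = 1)).card := by
  have hsub : R.filter (fun x => x < tA ∧ fA x = -1 ∧ f x = 1) ⊆
      R.filter (fun x => x < t ∧ f x = 1) ∪
        R.filter (fun x => t ≤ x ∧ x < tA ∧ fA x = -1 ∧ f x = 1) := by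
    intro x
    simp only [Finset.mem_filter, Finset.mem_union]
    grind
  have := (Finset.card_le_card hsub).trans (Finset.card_union_le _ _)
  unfold errOf
  omega

/-- If `t ≤ tA` has error at most that of `tA`, then the points reported negative in `[t, tA)` are
at most twice as many as the hidden positives there, up to the reported error at `tA`. -/
theorem card_reported_negative_le (R : Finset ℝ) (f fA : ℝ → ℤ)
    (hf : ∀ x ∈ R, f x = 1 ∨ f x = -1) (hfA : ∀ x ∈ R, fA x = 1 ∨ fA x = -1)
    {t tA : ℝ} (hle : t ≤ tA) (herr : errOf R f t ≤ errOf R f tA) :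
    (R.filter (fun x => t ≤ x ∧ x < tA ∧ fA x = -1)).card ≤
      2 * (R.filter (fun x => t ≤ x ∧ x < tA ∧ fA x = -1 ∧ f x = 1)).card +
        errOf R fA tA := by
  set K := R.filter (fun x => t ≤ x ∧ x < tA ∧ fA x = -1 ∧ f x = 1) with hK
  set N := R.filter (fun x => t ≤ x ∧ x < tA ∧ f x = -1) with hN
  set P := R.filter (fun x => x < tA ∧ fA x = 1) with hP
  have hsplit : (R.filter (fun x => t ≤ x ∧ x < tA ∧ fA x = -1)).card ≤ K.card + N.card := by
    refine (Finset.card_le_card ?_).trans (Finset.card_union_le _ _)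
    intro x
    simp only [hK, hN, Finset.mem_filter, Finset.mem_union]
    have := hf x
    grind
  have hneg : (R.filter (fun x => t ≤ x ∧ f x = -1)).card =
      N.card + (R.filter (fun x => tA ≤ x ∧ f x = -1)).card := by
    rw [← Finset.card_union_of_disjoint]
    · congr 1
      ext x
      simp only [hN, Finset.mem_filter, Finset.mem_union]
      grind
    · rw [Finset.disjoint_filter]
      grind
  have hpos : (R.filter (fun x => x < tA ∧ f x = 1)).card ≤
      (R.filter (fun x => x < t ∧ f x = 1)).card + (K.card + P.card) := by
    refine (Finset.card_le_card ?_).trans ((Finset.card_union_le _ (K ∪ P)).trans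
      (Nat.add_le_add_left (Finset.card_union_le _ _) _))
    intro x
    simp only [hK, hP, Finset.mem_filter, Finset.mem_union]
    have := hfA x
    grind
  rw [hP] at hpos
  unfold errOf at herr ⊢
  omega

/-- In a strictly decreasing list, the position of an element `≥ t` is bounded by the size of any
finite set containing all listed elements `≥ t`. -/
theorem succ_le_card_of_strictAnti {m : ℕ} {xs : Fin m → ℝ} (hanti : StrictAnti xs) {t : ℝ}
    {A : Finset ℝ} (hA : ∀ j, t ≤ xs j → xs j ∈ A) {i : Fin m} (hi : t ≤ xs i) :
    (i : ℕ) + 1 ≤ A.card := by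
  rw [← Fin.card_Iic i, ← Finset.card_image_of_injective _ hanti.injective]
  apply Finset.card_le_card
  intro x hx
  obtain ⟨j, hj, rfl⟩ := Finset.mem_image.1 hx
  exact hA j (hi.trans (hanti.antitone (Finset.mem_Iic.1 hj)))

/-- The sampling rate is large enough for `K ≥ k` hidden points among the first `2 K + E`. -/
theorem exp_neg_sampling_rate_le {k K E δ : ℝ} (hk : 0 < k) (hkK : k ≤ K) (hE : 0 ≤ E)
    (hδ0 : 0 < δ) (hδ1 : δ < 1) :
    Real.exp (-(K * ((2 + 2 * E / k) * Real.log (1 / δ) / (2 * K + E)))) ≤ δ := by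
  have hL : 0 < Real.log (1 / δ) := Real.log_pos (one_lt_one_div hδ0 hδ1)
  have hK : 0 < K := hk.trans_le hkK
  have hcoef : 2 * K + E ≤ K * (2 + 2 * E / k) := by
    have h : E ≤ K * (E / k) := by
      rw [mul_div_assoc', le_div_iff₀ hk]
      nlinarith
    have h' : K * (2 + 2 * E / k) = 2 * K + 2 * (K * (E / k)) := by ring
    linarith
  have hlog : Real.log (1 / δ) ≤ K * ((2 + 2 * E / k) * Real.log (1 / δ) / (2 * K + E)) := by
    rw [mul_div_assoc', le_div_iff₀ (by positivity)]
    nlinarith [mul_le_mul_of_nonneg_right hcoef hL.le]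
  calc _ ≤ Real.exp (-Real.log (1 / δ)) := Real.exp_le_exp.2 (neg_le_neg hlog)
    _ = δ := by rw [one_div, Real.log_inv, neg_neg, Real.exp_log hδ0]

/-- recall guarantee of the label-report protocol.  If the report
hides no negatives, then with probability at least 1 − δ the revealed responsive
set B⁺ satisfies |B⁺| ≥ N⁺ − (err* + k − 1), where B⁺ is all positives if some
sampled point is a true positive, and otherwise the positives with f_A(x) = +1
or x ≥ t*_A. -/
theorem stmt_1 (R : Finset ℝ) (hR : R.Nonempty) (f fA : ℝ → ℤ)
    (hf : ∀ x ∈ R, f x = 1 ∨ f x = -1)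
    (hfA : ∀ x ∈ R, fA x = 1 ∨ fA x = -1)
    (t₀ : ℝ) (ht₀ : ∀ x ∈ R, x < t₀)
    (tstar : ℝ) (htstar_mem : tstar ∈ insert t₀ R)
    (htstar_min : ∀ t ∈ insert t₀ R, errOf R f tstar ≤ errOf R f t)
    (htstar_largest : ∀ t ∈ insert t₀ R, errOf R f t = errOf R f tstar → t ≤ tstar)
    (tA : ℝ) (htA_mem : tA ∈ insert t₀ R)
    (htA_min : ∀ t ∈ insert t₀ R, errOf R fA tA ≤ errOf R fA t)
    (htA_smallest : ∀ t ∈ insert t₀ R, errOf R fA t = errOf R fA tA → tA ≤ t)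
    (hhide : ∀ x ∈ R, fA x = 1 → f x = 1)
    (k : ℕ) (hk : 1 ≤ k) (δ : ℝ) (hδ0 : 0 < δ) (hδ1 : δ < 1)
    (Nplus : ℕ) (hNplus : Nplus = (R.filter (fun x => f x = 1)).card)
    (hNplus1 : 1 ≤ Nplus)
    -- the points of {x ∈ R : x < t*_A, f_A(x) = −1} listed in decreasing order
    (m : ℕ) (xs : Fin m → ℝ) (hxs_anti : StrictAnti xs)
    (hxs_mem : ∀ i, xs i ∈ R ∧ xs i < tA ∧ fA (xs i) = -1)
    (hxs_surj : ∀ x ∈ R, x < tA → fA x = -1 → ∃ i, xs i = x)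
    -- the independent sampling variables
    {Ω : Type} [MeasurableSpace Ω] (μ : Measure Ω) [IsProbabilityMeasure μ]
    (Y : Fin m → Ω → Bool)
    (hYmeas : ∀ i, Measurable (Y i))
    (hYindep : iIndepFun Y μ)
    (c : ℝ) (hc : c = (2 + 2 * (errOf R fA tA : ℝ) / (k : ℝ)) * Real.log (1 / δ))
    (hY : ∀ i : Fin m, μ {ω | Y i ω = true} = ENNReal.ofReal (min 1 (c / ((i : ℕ) + 1))))
    -- the (random) revealed responsive set B⁺
    (Bplus : Ω → Finset ℝ)
    (hBdet : ∀ ω, (∃ i, Y i ω = true ∧ f (xs i) = 1) →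
      Bplus ω = R.filter (fun x => f x = 1))
    (hBnodet : ∀ ω, (¬ ∃ i, Y i ω = true ∧ f (xs i) = 1) →
      Bplus ω = R.filter (fun x => f x = 1 ∧ (fA x = 1 ∨ tA ≤ x))) :
    ENNReal.ofReal (1 - δ) ≤
      μ {ω | (Nplus : ℤ) - ((errOf R f tstar : ℤ) + (k : ℤ) - 1) ≤ ((Bplus ω).card : ℤ)} := by
  have hcard := card_positives_eq_add_card_hidden R f fA hfA tA
  have hbelow := card_hidden_le_errOf_add R f fA tstar tA
  set H := R.filter (fun x => x < tA ∧ fA x = -1 ∧ f x = 1) with hH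
  set G := R.filter (fun x => tstar ≤ x ∧ x < tA ∧ fA x = -1 ∧ f x = 1) with hG
  have hdetected : ∀ ω, (∃ i, Y i ω = true ∧ f (xs i) = 1) →
      (Nplus : ℤ) - ((errOf R f tstar : ℤ) + (k : ℤ) - 1) ≤ ((Bplus ω).card : ℤ) := by
    intro ω hω
    rw [hBdet ω hω, ← hNplus]
    omega
  by_cases hfew : H.card + 1 ≤ errOf R f tstar + k
  · have huniv : {ω | (Nplus : ℤ) - ((errOf R f tstar : ℤ) + (k : ℤ) - 1) ≤
        ((Bplus ω).card : ℤ)} = Set.univ := by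
      refine Set.eq_univ_of_forall fun ω => ?_
      by_cases hω : ∃ i, Y i ω = true ∧ f (xs i) = 1
      · exact hdetected ω hω
      · rw [Set.mem_ofPred_eq, hBnodet ω hω]
        omega
    rw [huniv, measure_univ]
    exact ENNReal.ofReal_le_one.2 (by linarith)
  have hkG : k ≤ G.card := by omega
  have hle : tstar ≤ tA := by
    obtain ⟨x, hx⟩ := Finset.card_pos.1 (by omega : 0 < G.card)
    rw [hG, Finset.mem_filter] at hx
    exact hx.2.1.trans hx.2.2.1.le
  have hlist := card_reported_negative_le R f fA hf hfA hle (htstar_min tA htA_mem)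
  rw [← hG] at hlist
  set S : Finset (Fin m) := Finset.univ.filter (fun i => tstar ≤ xs i ∧ f (xs i) = 1) with hS
  have hScard : S.card = G.card := by
    rw [← Finset.card_image_of_injective S hxs_anti.injective]
    congr 1
    ext x
    simp only [hS, hG, Finset.mem_image, Finset.mem_filter, Finset.mem_univ, true_and]
    constructor
    · rintro ⟨i, hi, rfl⟩
      have := hxs_mem i
      tauto
    · rintro ⟨hxR, htx, hxA, hneg, hpos⟩
      obtain ⟨i, rfl⟩ := hxs_surj x hxR hxA hneg
      exact ⟨i, ⟨htx, hpos⟩, rfl⟩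
  have hk0 : (0 : ℝ) < k := by exact_mod_cast hk
  have hkG' : (k : ℝ) ≤ G.card := by exact_mod_cast hkG
  have hc0 : 0 ≤ c := by
    have := Real.log_pos (one_lt_one_div hδ0 hδ1)
    rw [hc]
    positivity
  have hrate : ∀ i ∈ S, ENNReal.ofReal (min 1 (c / (2 * G.card + errOf R fA tA))) ≤
      μ {ω | Y i ω = true} := by
    intro i hi
    rw [hS, Finset.mem_filter] at hi
    have hpos : (i : ℕ) + 1 ≤ 2 * G.card + errOf R fA tA :=
      (succ_le_card_of_strictAnti hxs_anti (fun j hj => Finset.mem_filter.2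
        ⟨(hxs_mem j).1, hj, (hxs_mem j).2⟩) hi.2.1).trans hlist
    rw [hY i]
    refine ENNReal.ofReal_le_ofReal (min_le_min_left _ ?_)
    exact div_le_div_of_nonneg_left hc0 (by positivity) (by exact_mod_cast hpos)
  have hmiss : μ (⋂ i ∈ S, {ω | Y i ω = false}) ≤ ENNReal.ofReal δ := by
    refine (measure_iInter_eq_false_le hYmeas hYindep S (by positivity) hrate).trans
      (ENNReal.ofReal_le_ofReal ?_)
    rw [hScard, hc]
    exact exp_neg_sampling_rate_le hk0 hkG' (Nat.cast_nonneg _) hδ0 hδ1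
  have hmeas : MeasurableSet (⋂ i ∈ S, {ω | Y i ω = false}) :=
    S.measurableSet_biInter fun i _ => hYmeas i (measurableSet_singleton false)
  calc ENNReal.ofReal (1 - δ) = 1 - ENNReal.ofReal δ := by
        rw [ENNReal.ofReal_sub _ hδ0.le, ENNReal.ofReal_one]
    _ ≤ 1 - μ (⋂ i ∈ S, {ω | Y i ω = false}) := tsub_le_tsub_left hmiss 1
    _ = μ (⋂ i ∈ S, {ω | Y i ω = false})ᶜ := (prob_compl_eq_one_sub hmeas).symm
    _ ≤ _ := by
        refine measure_mono fun ω hω => hdetected ω ?_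
        simp only [Set.mem_compl_iff, Set.mem_iInter, Set.mem_ofPred_eq, not_forall,
          Bool.not_eq_false] at hω
        obtain ⟨i, hi, hYi⟩ := hω
        exact ⟨i, hYi, (Finset.mem_filter.1 hi).2.2⟩
end

section
/- Assume the report is truthful, f_A = f, and let N⁻ = |{x ∈ R : f(x) = −1}| ≥ 1 and err* = err(t*) = min over T of err. Define the non-responsive disclosure NRD = |{x ∈ R : x ≥ t*_A and f(x) = −1}| + |{i ∈ {1,…,m} : Y_i = 1}| (note that under a truthful report every listed point x₍ᵢ₎ is a true negative). Then E[NRD] ≤ (2 + 2·err*/k)·(1 + ln N⁻)·ln(1/δ) + err*. -/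
open MeasureTheory ProbabilityTheory

/-- Linearity of expectation for the number of Bernoulli variables that are `true`. -/
theorem integrable_and_integral_card_filter {ι Ω : Type*} [Fintype ι] [MeasurableSpace Ω]
    (μ : Measure Ω) [IsFiniteMeasure μ] {Y : ι → Ω → Bool} (hY : ∀ i, Measurable (Y i)) :
    Integrable (fun ω => ((Finset.univ.filter (fun i => Y i ω = true)).card : ℝ)) μ ∧
      ∫ ω, ((Finset.univ.filter (fun i => Y i ω = true)).card : ℝ) ∂μ =
        ∑ i, μ.real {ω | Y i ω = true} := by
  have hmeas : ∀ i, MeasurableSet {ω | Y i ω = true} := fun i =>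
    hY i (measurableSet_singleton true)
  have hcard : (fun ω => ((Finset.univ.filter (fun i => Y i ω = true)).card : ℝ)) =
      fun ω => ∑ i, {ω | Y i ω = true}.indicator (1 : Ω → ℝ) ω := by
    funext ω
    simp [Set.indicator_apply]
  have hint : ∀ i, Integrable ({ω | Y i ω = true}.indicator (1 : Ω → ℝ)) μ := fun i =>
    (integrable_const (1 : ℝ)).indicator (hmeas i)
  rw [hcard]
  refine ⟨integrable_finsetSum _ fun i _ => hint i, ?_⟩
  rw [integral_finsetSum _ fun i _ => hint i]
  exact Finset.sum_congr rfl fun i _ => integral_indicator_one (hmeas i)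

/-- A partial harmonic sum with at most `n` terms is bounded by `1 + log n`. -/
theorem sum_fin_inv_le_one_add_log {m n : ℕ} (hmn : m ≤ n) :
    ∑ i : Fin m, ((i : ℕ) + 1 : ℝ)⁻¹ ≤ 1 + Real.log n := by
  calc ∑ i : Fin m, ((i : ℕ) + 1 : ℝ)⁻¹
      = ∑ i ∈ Finset.range m, ((i : ℝ) + 1)⁻¹ :=
        Fin.sum_univ_eq_sum_range (fun i => ((i : ℝ) + 1)⁻¹) m
    _ ≤ ∑ i ∈ Finset.range n, ((i : ℝ) + 1)⁻¹ :=
        Finset.sum_le_sum_of_subset_of_nonneg (Finset.range_mono hmn)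
          fun i _ _ => by positivity
    _ = (harmonic n : ℝ) := by simp [harmonic]
    _ ≤ 1 + Real.log n := harmonic_le_one_add_log n

/-- under a truthful report f_A = f, the expected non-responsive
disclosure NRD = #{true negatives ≥ t*_A} + #{sampled indices} is at most
(2 + 2·err*/k)·(1 + ln N⁻)·ln(1/δ) + err*. -/
theorem stmt_2 (R : Finset ℝ) (hR : R.Nonempty) (f fA : ℝ → ℤ)
    (hf : ∀ x ∈ R, f x = 1 ∨ f x = -1)
    (htruth : fA = f)
    (t₀ : ℝ) (ht₀ : ∀ x ∈ R, x < t₀)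
    (tstar : ℝ) (htstar_mem : tstar ∈ insert t₀ R)
    (htstar_min : ∀ t ∈ insert t₀ R, errOf R f tstar ≤ errOf R f t)
    (htstar_largest : ∀ t ∈ insert t₀ R, errOf R f t = errOf R f tstar → t ≤ tstar)
    (tA : ℝ) (htA_mem : tA ∈ insert t₀ R)
    (htA_min : ∀ t ∈ insert t₀ R, errOf R fA tA ≤ errOf R fA t)
    (htA_smallest : ∀ t ∈ insert t₀ R, errOf R fA t = errOf R fA tA → tA ≤ t)
    (k : ℕ) (hk : 1 ≤ k) (δ : ℝ) (hδ0 : 0 < δ) (hδ1 : δ < 1)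
    (Nneg : ℕ) (hNneg : Nneg = (R.filter (fun x => f x = -1)).card)
    (hNneg1 : 1 ≤ Nneg)
    -- the points of {x ∈ R : x < t*_A, f_A(x) = −1} listed in decreasing order
    (m : ℕ) (xs : Fin m → ℝ) (hxs_anti : StrictAnti xs)
    (hxs_mem : ∀ i, xs i ∈ R ∧ xs i < tA ∧ fA (xs i) = -1)
    (hxs_surj : ∀ x ∈ R, x < tA → fA x = -1 → ∃ i, xs i = x)
    -- the independent sampling variables
    {Ω : Type} [MeasurableSpace Ω] (μ : Measure Ω) [IsProbabilityMeasure μ]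
    (Y : Fin m → Ω → Bool)
    (hYmeas : ∀ i, Measurable (Y i))
    (hYindep : iIndepFun Y μ)
    (c : ℝ) (hc : c = (2 + 2 * (errOf R fA tA : ℝ) / (k : ℝ)) * Real.log (1 / δ))
    (hY : ∀ i : Fin m, μ {ω | Y i ω = true} = ENNReal.ofReal (min 1 (c / ((i : ℕ) + 1))))
    -- the (random) non-responsive disclosure
    (NRD : Ω → ℕ)
    (hNRD : ∀ ω, NRD ω = (R.filter (fun x => tA ≤ x ∧ f x = -1)).card +
      (Finset.univ.filter (fun i : Fin m => Y i ω = true)).card) :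
    ∫ ω, (NRD ω : ℝ) ∂μ ≤
      (2 + 2 * (errOf R f tstar : ℝ) / (k : ℝ)) * (1 + Real.log (Nneg : ℝ)) *
        Real.log (1 / δ) + (errOf R f tstar : ℝ) := by
  subst htruth
  have herr : errOf R fA tA = errOf R fA tstar :=
    le_antisymm (htA_min _ htstar_mem) (htstar_min _ htA_mem)
  have hm : m ≤ Nneg := by
    rw [hNneg, ← Fintype.card_fin m, ← Finset.card_univ]
    exact Finset.card_le_card_of_injOn xs
      (fun i _ => by simpa using ⟨(hxs_mem i).1, (hxs_mem i).2.2⟩) hxs_anti.injective.injOn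
  have hlog : 0 ≤ Real.log (1 / δ) :=
    Real.log_nonneg ((one_le_div hδ0).2 hδ1.le)
  have hc0 : 0 ≤ c := by rw [hc]; positivity
  have hprob : ∀ i : Fin m, μ.real {ω | Y i ω = true} ≤ c * ((i : ℕ) + 1 : ℝ)⁻¹ := by
    intro i
    rw [measureReal_def, hY i, ENNReal.toReal_ofReal (le_min zero_le_one (by positivity)),
      ← div_eq_mul_inv]
    exact min_le_right _ _
  obtain ⟨hint, hsum⟩ := integrable_and_integral_card_filter μ hYmeas
  have hneg : ((R.filter (fun x => tA ≤ x ∧ fA x = -1)).card : ℝ) ≤ errOf R fA tstar := by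
    rw [← herr]
    exact_mod_cast Nat.le_add_right _ _
  have hsampled : ∑ i, μ.real {ω | Y i ω = true} ≤ c * (1 + Real.log Nneg) :=
    (Finset.sum_le_sum fun i _ => hprob i).trans <| by
      rw [← Finset.mul_sum]
      exact mul_le_mul_of_nonneg_left (sum_fin_inv_le_one_add_log hm) hc0
  simp only [hNRD, Nat.cast_add]
  rw [integral_add (integrable_const _) hint, hsum, integral_const, probReal_univ, one_smul]
  rw [hc, herr] at hsampled
  linarith
end

section
/- Assume the report f_A hides no negatives, let k ≥ 1 be an integer and δ ∈ (0,1), and suppose err(t*_A) ≥ err(t*) + k. Then with probability at least 1 − δ there exists an index i ∈ {1,…,m} with Y_i = 1 and f(x₍ᵢ₎) = +1 (i.e., the sampling detects a true positive point that the report labeled negative). -/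
open MeasureTheory ProbabilityTheory

/-- Moving the threshold from `s` up to `t` trades the negatives in `[s, t)` for the positives. -/
theorem errOf_add_card_pos (R : Finset ℝ) (g : ℝ → ℤ) {s t : ℝ} (hst : s ≤ t) :
    errOf R g s + (R.filter (fun x => s ≤ x ∧ x < t ∧ g x = 1)).card =
      errOf R g t + (R.filter (fun x => s ≤ x ∧ x < t ∧ g x = -1)).card := by
  simp only [errOf, Finset.card_filter, ← Finset.sum_add_distrib]
  refine Finset.sum_congr rfl fun x _ => ?_
  grind

/-- If the report hides no negatives, a threshold above a minimizer of the reported error has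
true error at least that of the minimizer. -/
theorem errOf_le_of_hides_no_negatives {R : Finset ℝ} {f fA : ℝ → ℤ}
    (hfA : ∀ x ∈ R, fA x = 1 ∨ fA x = -1) (hhide : ∀ x ∈ R, fA x = 1 → f x = 1)
    {s t : ℝ} (hst : s ≤ t) (hmin : errOf R fA s ≤ errOf R fA t) :
    errOf R f s ≤ errOf R f t := by
  have h1 := errOf_add_card_pos R f hst
  have h2 := errOf_add_card_pos R fA hst
  have hpos : (R.filter (fun x => s ≤ x ∧ x < t ∧ fA x = 1)).card ≤
      (R.filter (fun x => s ≤ x ∧ x < t ∧ f x = 1)).card := by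
    refine Finset.card_le_card fun x hx => ?_
    grind
  have hneg : (R.filter (fun x => s ≤ x ∧ x < t ∧ f x = -1)).card ≤
      (R.filter (fun x => s ≤ x ∧ x < t ∧ fA x = -1)).card := by
    refine Finset.card_le_card fun x hx => ?_
    grind
  omega

/-- Among the reported negatives in `[s, t)`, a fraction at least `1 / (2 + 2 * errOf R fA t / k)`
are true positives. -/
theorem card_reported_neg_le {R : Finset ℝ} {f fA : ℝ → ℤ}
    (hf : ∀ x ∈ R, f x = 1 ∨ f x = -1) (hfA : ∀ x ∈ R, fA x = 1 ∨ fA x = -1)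
    (hhide : ∀ x ∈ R, fA x = 1 → f x = 1) {s t : ℝ} (hst : s ≤ t)
    (hmin : errOf R fA t ≤ errOf R fA s) {k : ℕ} (hk : 1 ≤ k)
    (hgap : errOf R f s + k ≤ errOf R f t) :
    ((R.filter (fun x => s ≤ x ∧ x < t ∧ fA x = -1)).card : ℝ) ≤
      (2 + 2 * (errOf R fA t : ℝ) / (k : ℝ)) *
        (R.filter (fun x => s ≤ x ∧ x < t ∧ fA x = -1 ∧ f x = 1)).card := by
  have h1 := errOf_add_card_pos R f hst
  have h2 := errOf_add_card_pos R fA hst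
  have hpos : (R.filter (fun x => s ≤ x ∧ x < t ∧ f x = 1)).card =
      (R.filter (fun x => s ≤ x ∧ x < t ∧ fA x = 1)).card +
        (R.filter (fun x => s ≤ x ∧ x < t ∧ fA x = -1 ∧ f x = 1)).card := by
    simp only [Finset.card_filter, ← Finset.sum_add_distrib]
    refine Finset.sum_congr rfl fun x hx => ?_
    grind
  have hneg : (R.filter (fun x => s ≤ x ∧ x < t ∧ fA x = -1)).card =
      (R.filter (fun x => s ≤ x ∧ x < t ∧ f x = -1)).card +
        (R.filter (fun x => s ≤ x ∧ x < t ∧ fA x = -1 ∧ f x = 1)).card := by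
    simp only [Finset.card_filter, ← Finset.sum_add_distrib]
    refine Finset.sum_congr rfl fun x hx => ?_
    grind
  have hle : (R.filter (fun x => s ≤ x ∧ x < t ∧ fA x = 1)).card ≤ errOf R fA t := by
    refine le_trans (Finset.card_le_card fun x hx => ?_) (Nat.le_add_left _ _)
    grind
  generalize (R.filter (fun x => s ≤ x ∧ x < t ∧ fA x = -1)).card = I at *
  generalize (R.filter (fun x => s ≤ x ∧ x < t ∧ fA x = -1 ∧ f x = 1)).card = h at *
  generalize errOf R fA t = E at *
  have hkh : (k : ℝ) ≤ 2 * h := by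
    have : k ≤ 2 * h := by omega
    exact_mod_cast this
  have hI : (I : ℝ) ≤ 2 * h + E := by
    have : I ≤ 2 * h + E := by omega
    exact_mod_cast this
  have hk0 : (0 : ℝ) < k := by exact_mod_cast hk
  have hE : (E : ℝ) ≤ 2 * E / k * h := by
    rw [div_mul_eq_mul_div, le_div_iff₀ hk0]
    nlinarith [Nat.cast_nonneg (α := ℝ) E]
  linarith

/-- Independent events indexed by `H`, each of probability at least `min 1 p`, all fail with
probability at most `exp (-p * |H|)`. -/
theorem measure_all_false_le {ι Ω : Type*} [MeasurableSpace Ω] {μ : Measure Ω}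
    [IsProbabilityMeasure μ] {Y : ι → Ω → Bool} (hYmeas : ∀ i, Measurable (Y i))
    (hYindep : iIndepFun Y μ) (H : Finset ι) {p : ℝ} (hp : 0 ≤ p)
    (hY : ∀ i ∈ H, ENNReal.ofReal (min 1 p) ≤ μ {ω | Y i ω = true}) :
    μ (⋂ i ∈ H, Y i ⁻¹' {false}) ≤ ENNReal.ofReal (Real.exp (-(p * H.card))) := by
  rw [hYindep.measure_inter_preimage_eq_mul H (fun _ _ => measurableSet_singleton _)]
  have hfactor : ∀ i ∈ H, μ (Y i ⁻¹' {false}) ≤ ENNReal.ofReal (Real.exp (-p)) := by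
    intro i hi
    have hcompl : Y i ⁻¹' {false} = {ω | Y i ω = true}ᶜ := by
      ext ω
      simp
    have hmeas : MeasurableSet {ω | Y i ω = true} := hYmeas i (measurableSet_singleton true)
    rw [hcompl, prob_compl_eq_one_sub hmeas]
    refine (tsub_le_tsub_left (hY i hi) 1).trans ?_
    rw [← ENNReal.ofReal_one, ← ENNReal.ofReal_sub _ (le_min zero_le_one hp)]
    refine ENNReal.ofReal_le_ofReal ?_
    rcases min_cases 1 p with ⟨h, _⟩ | ⟨h, _⟩ <;> rw [h]
    · simpa using (Real.exp_pos _).le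
    · linarith [Real.add_one_le_exp (-p)]
  refine (Finset.prod_le_prod' hfactor).trans_eq ?_
  rw [Finset.prod_const, ← ENNReal.ofReal_pow (Real.exp_pos _).le, ← Real.exp_nat_mul]
  congr 2
  ring

/-- if the report hides no negatives and err(t*_A) ≥ err(t*) + k,
then with probability at least 1 − δ the independent sampling
(P(Y_i = 1) = min(1, c/i), c = (2 + 2·err_A(t*_A)/k)·ln(1/δ), over the points
x₍₁₎ > ⋯ > x₍ₘ₎ of {x ∈ R : x < t*_A, f_A(x) = −1}) samples a true positive
point that the report labeled negative. -/
theorem stmt_3 (R : Finset ℝ) (hR : R.Nonempty) (f fA : ℝ → ℤ)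
    (hf : ∀ x ∈ R, f x = 1 ∨ f x = -1)
    (hfA : ∀ x ∈ R, fA x = 1 ∨ fA x = -1)
    (t₀ : ℝ) (ht₀ : ∀ x ∈ R, x < t₀)
    (tstar : ℝ) (htstar_mem : tstar ∈ insert t₀ R)
    (htstar_min : ∀ t ∈ insert t₀ R, errOf R f tstar ≤ errOf R f t)
    (htstar_largest : ∀ t ∈ insert t₀ R, errOf R f t = errOf R f tstar → t ≤ tstar)
    (tA : ℝ) (htA_mem : tA ∈ insert t₀ R)
    (htA_min : ∀ t ∈ insert t₀ R, errOf R fA tA ≤ errOf R fA t)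
    (htA_smallest : ∀ t ∈ insert t₀ R, errOf R fA t = errOf R fA tA → tA ≤ t)
    (hhide : ∀ x ∈ R, fA x = 1 → f x = 1)
    (k : ℕ) (hk : 1 ≤ k) (δ : ℝ) (hδ0 : 0 < δ) (hδ1 : δ < 1)
    (hgap : errOf R f tstar + k ≤ errOf R f tA)
    -- the points of {x ∈ R : x < t*_A, f_A(x) = −1} listed in decreasing order
    (m : ℕ) (xs : Fin m → ℝ) (hxs_anti : StrictAnti xs)
    (hxs_mem : ∀ i, xs i ∈ R ∧ xs i < tA ∧ fA (xs i) = -1)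
    (hxs_surj : ∀ x ∈ R, x < tA → fA x = -1 → ∃ i, xs i = x)
    -- the independent sampling variables
    {Ω : Type} [MeasurableSpace Ω] (μ : Measure Ω) [IsProbabilityMeasure μ]
    (Y : Fin m → Ω → Bool)
    (hYmeas : ∀ i, Measurable (Y i))
    (hYindep : iIndepFun Y μ)
    (c : ℝ) (hc : c = (2 + 2 * (errOf R fA tA : ℝ) / (k : ℝ)) * Real.log (1 / δ))
    (hY : ∀ i : Fin m, μ {ω | Y i ω = true} = ENNReal.ofReal (min 1 (c / ((i : ℕ) + 1)))) :
    ENNReal.ofReal (1 - δ) ≤ μ {ω | ∃ i, Y i ω = true ∧ f (xs i) = 1} := by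
  have hlt : tstar < tA := by
    by_contra! hle
    have := errOf_le_of_hides_no_negatives hfA hhide hle (htA_min tstar htstar_mem)
    omega
  have hcount := card_reported_neg_le hf hfA hhide hlt.le (htA_min tstar htstar_mem) hk hgap
  set S : Finset (Fin m) := Finset.univ.filter (fun i => tstar ≤ xs i) with hS
  set H : Finset (Fin m) := Finset.univ.filter (fun i => tstar ≤ xs i ∧ f (xs i) = 1) with hH
  have hScard : (R.filter (fun x => tstar ≤ x ∧ x < tA ∧ fA x = -1)).card = S.card := by
    rw [← Finset.card_image_of_injective S hxs_anti.injective]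
    congr 1
    ext x
    simp only [hS, Finset.mem_filter, Finset.mem_image, Finset.mem_univ, true_and]
    grind
  have hHcard : (R.filter (fun x => tstar ≤ x ∧ x < tA ∧ fA x = -1 ∧ f x = 1)).card =
      H.card := by
    rw [← Finset.card_image_of_injective H hxs_anti.injective]
    congr 1
    ext x
    simp only [hH, Finset.mem_filter, Finset.mem_image, Finset.mem_univ, true_and]
    grind
  rw [hScard, hHcard] at hcount
  have hindex : ∀ i ∈ H, (i : ℕ) + 1 ≤ S.card := by
    intro i hi
    rw [← Fin.card_Iic]
    refine Finset.card_le_card fun j hj => ?_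
    simp only [hS, hH, Finset.mem_filter, Finset.mem_univ, true_and, Finset.mem_Iic] at hi hj ⊢
    exact hi.1.trans (hxs_anti.antitone hj)
  have hlog : 0 < Real.log (1 / δ) := Real.log_pos ((one_lt_div hδ0).mpr hδ1)
  have hc0 : 0 ≤ c := by
    rw [hc]
    positivity
  have hSpos : (0 : ℝ) < S.card := by
    have hadd := errOf_add_card_pos R fA hlt.le
    have hadd' := errOf_add_card_pos R f hlt.le
    have hmin := htA_min tstar htstar_mem
    rw [hScard] at hadd
    rcases Nat.eq_zero_or_pos S.card with h0 | h0
    · exfalso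
      have hpos : (R.filter (fun x => tstar ≤ x ∧ x < tA ∧ f x = 1)).card ≤
          (R.filter (fun x => tstar ≤ x ∧ x < tA ∧ fA x = 1)).card + S.card := by
        rw [← hScard, Finset.card_filter, Finset.card_filter, Finset.card_filter,
          ← Finset.sum_add_distrib]
        refine Finset.sum_le_sum fun x hx => ?_
        grind
      omega
    · exact_mod_cast h0
  have hbound := measure_all_false_le hYmeas hYindep H (p := c / S.card) (by positivity) (by
    intro i hi
    rw [hY i]
    refine ENNReal.ofReal_le_ofReal (min_le_min_left 1 ?_)
    refine div_le_div_of_nonneg_left hc0 (by positivity) ?_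
    exact_mod_cast hindex i hi)
  have hexp : Real.exp (-(c / S.card * H.card)) ≤ δ := by
    rw [← Real.le_log_iff_exp_le hδ0, neg_le, ← Real.log_inv, ← one_div, div_mul_eq_mul_div,
      le_div_iff₀ hSpos, hc]
    nlinarith
  have hB : MeasurableSet (⋂ i ∈ H, Y i ⁻¹' {false}) :=
    Finset.measurableSet_biInter H fun i _ => hYmeas i (measurableSet_singleton _)
  calc ENNReal.ofReal (1 - δ) = 1 - ENNReal.ofReal δ := by
        rw [ENNReal.ofReal_sub _ hδ0.le, ENNReal.ofReal_one]
    _ ≤ 1 - μ (⋂ i ∈ H, Y i ⁻¹' {false}) :=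
        tsub_le_tsub_left (hbound.trans (ENNReal.ofReal_le_ofReal hexp)) 1
    _ = μ (⋂ i ∈ H, Y i ⁻¹' {false})ᶜ := (prob_compl_eq_one_sub hB).symm
    _ ≤ μ {ω | ∃ i, Y i ω = true ∧ f (xs i) = 1} := by
        refine measure_mono fun ω hω => ?_
        simp only [Set.mem_compl_iff, Set.mem_iInter, not_forall, Set.mem_preimage,
          Set.mem_singleton_iff, Bool.not_eq_false] at hω
        obtain ⟨i, hi, hYi⟩ := hω
        exact ⟨i, hYi, (Finset.mem_filter.mp hi).2.2⟩
end

section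
/- Let a = |{i : ε_i = +1}|, b = |{i : ε_i = −1}|, let δ ∈ (0,1) and c = 2·ln(m/δ). If a > 3b, then with probability at least 1 − δ there exists an index i ≤ m with M⁺_i > i − M⁺_i (i.e., at some point the number of sampled positives strictly exceeds the number of remaining scanned points). -/
open MeasureTheory ProbabilityTheory

/-- Along a single path: if every window `(s, t]` with a positive label sum contains a positive
label that would be sampled by a process restarted after `s`, then the labels that are not sampled
positives have nonpositive sum. -/
lemma sum_unsampled_nonpos (m : ℕ) (ε : ℕ → ℤ) (c : ℝ) (u w : ℕ → ℝ) (S : ℕ → Bool)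
    (hw1 : w 1 = 1)
    (hS : ∀ i, S i = true ↔ u i ≤ min 1 (c / w i))
    (hwsucc : ∀ i, w (i + 1) = if S i = true ∧ ε i = 1 then 1 else w i + 1)
    (hgood : ∀ s < m, ∀ t ∈ Finset.Ioc s m, 0 < ∑ l ∈ Finset.Ioc s t, ε l →
      ∃ l ∈ Finset.Ioc s t, ε l = 1 ∧ u l ≤ min 1 (c / ((l : ℝ) - s))) :
    ∑ l ∈ Finset.Ioc 0 m, (if S l = true ∧ ε l = 1 then 0 else ε l) ≤ 0 := by
  set x : ℕ → ℤ := fun l => if S l = true ∧ ε l = 1 then 0 else ε l with hx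
  have extend : ∀ s i, s ≤ i → i ≤ m → ∑ l ∈ Finset.Ioc 0 s, x l ≤ 0 →
      (∀ l ∈ Finset.Ioc s i, ¬ (S l = true ∧ ε l = 1)) →
      (∀ l ∈ Finset.Ioc s i, w l = (l : ℝ) - s) → ∑ l ∈ Finset.Ioc 0 i, x l ≤ 0 := by
    intro s i hsi him hsum hno hwl
    rw [← Finset.sum_Ioc_consecutive x (Nat.zero_le s) hsi]
    have hxe : ∑ l ∈ Finset.Ioc s i, x l = ∑ l ∈ Finset.Ioc s i, ε l :=
      Finset.sum_congr rfl fun l hl => if_neg (hno l hl)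
    have hnonpos : ∑ l ∈ Finset.Ioc s i, ε l ≤ 0 := by
      by_contra! hpos
      have hlt : s < i := by
        rcases hsi.lt_or_eq with h | h
        · exact h
        · simp [h] at hpos
      obtain ⟨l, hl, hl1, hlu⟩ :=
        hgood s (hlt.trans_le him) i (Finset.mem_Ioc.2 ⟨hlt, him⟩) hpos
      exact hno l hl ⟨(hS l).2 (by rwa [hwl l hl]), hl1⟩
    omega
  have invariant : ∀ i ≤ m, ∃ s ≤ i, ∑ l ∈ Finset.Ioc 0 s, x l ≤ 0 ∧
      (∀ l ∈ Finset.Ioc s i, ¬ (S l = true ∧ ε l = 1)) ∧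
      (∀ l ∈ Finset.Ioc s (i + 1), w l = (l : ℝ) - s) := by
    intro i
    induction i with
    | zero =>
      intro _
      refine ⟨0, le_rfl, by simp, by simp, ?_⟩
      intro l hl
      obtain rfl : l = 1 := by simp at hl; omega
      simp [hw1]
    | succ i ih =>
      intro him
      obtain ⟨s, hsi, hsum, hno, hwl⟩ := ih (by omega)
      by_cases hs : S (i + 1) = true ∧ ε (i + 1) = 1
      · refine ⟨i + 1, le_rfl, ?_, by simp, ?_⟩
        · rw [Finset.sum_Ioc_succ_top (Nat.zero_le i)]
          have h0 : x (i + 1) = 0 := if_pos hs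
          rw [h0, add_zero]
          exact extend s i hsi (by omega) hsum hno fun l hl => hwl l (by simp at hl ⊢; omega)
        · intro l hl
          obtain rfl : l = i + 1 + 1 := by simp at hl; omega
          rw [hwsucc, if_pos hs]
          push_cast
          ring
      · refine ⟨s, by omega, hsum, ?_, ?_⟩
        · intro l hl
          by_cases h : l = i + 1
          · rwa [h]
          · exact hno l (by simp at hl ⊢; omega)
        · intro l hl
          by_cases h : l = i + 1 + 1
          · rw [h, hwsucc, if_neg hs, hwl (i + 1) (by simp; omega)]
            push_cast
            ring
          · exact hwl l (by simp at hl ⊢; omega)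
  obtain ⟨s, hsm, hsum, hno, hwl⟩ := invariant m le_rfl
  exact extend s m hsm le_rfl hsum hno fun l hl => hwl l (by simp at hl ⊢; omega)

/-- The upper tail of a uniform random variable on `[0, 1]` is at most exponential. -/
lemma measure_min_one_lt_le_exp {Ω : Type*} [MeasurableSpace Ω] {μ : Measure Ω} {X : Ω → ℝ}
    (hX : Measurable X) (hunif : Measure.map X μ = volume.restrict (Set.Icc (0 : ℝ) 1))
    (p : ℝ) :
    μ (X ⁻¹' Set.Ioi (min 1 p)) ≤ ENNReal.ofReal (Real.exp (-p)) := by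
  rw [← Measure.map_apply hX measurableSet_Ioi, hunif, Measure.restrict_apply measurableSet_Ioi]
  calc volume (Set.Ioi (min 1 p) ∩ Set.Icc 0 1)
      ≤ volume (Set.Ioc (min 1 p) 1) := measure_mono fun y hy => ⟨hy.1, hy.2.2⟩
    _ = ENNReal.ofReal (1 - min 1 p) := Real.volume_Ioc
    _ ≤ ENNReal.ofReal (Real.exp (-p)) := by
      apply ENNReal.ofReal_le_ofReal
      rcases min_cases 1 p with ⟨h, _⟩ | ⟨h, _⟩ <;> rw [h]
      · simpa using (Real.exp_pos (-p)).le
      · linarith [Real.add_one_le_exp (-p)]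

/-- A window whose labels are `±1` with positive sum has a strict majority of `+1` labels. -/
lemma card_lt_two_mul_card_filter_of_sum_pos (A : Finset ℕ) (ε : ℕ → ℤ)
    (hε : ∀ i ∈ A, ε i = 1 ∨ ε i = -1) (hpos : 0 < ∑ l ∈ A, ε l) :
    A.card < 2 * (A.filter fun l => ε l = 1).card := by
  have h : ∑ l ∈ A, ε l = ∑ l ∈ A, (2 * (if ε l = 1 then 1 else 0) - 1 : ℤ) := by
    refine Finset.sum_congr rfl fun l hl => ?_
    rcases hε l hl with h | h <;> simp [h]
  rw [h, Finset.sum_sub_distrib, ← Finset.mul_sum] at hpos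
  simp only [Finset.sum_boole, Finset.sum_const, nsmul_eq_mul, mul_one] at hpos
  omega

/-- The process restarted after `s` misses every positive label of a window with positive label sum
with probability at most `exp (-c / 2)`. -/
lemma measure_window_missed_le (m : ℕ) (ε : ℕ → ℤ)
    (hε : ∀ i ∈ Finset.Icc 1 m, ε i = 1 ∨ ε i = -1) {c : ℝ} (hc : 0 ≤ c)
    {Ω : Type*} [MeasurableSpace Ω] (μ : Measure Ω)
    (U : ℕ → Ω → ℝ) (hUmeas : ∀ i, Measurable (U i))
    (hUindep : iIndepFun (fun i : Fin m => U ((i : ℕ) + 1)) μ)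
    (hUunif : ∀ i ∈ Finset.Icc 1 m, Measure.map (U i) μ = volume.restrict (Set.Icc (0 : ℝ) 1))
    {s t : ℕ} (hst : s < t) (htm : t ≤ m) (hpos : 0 < ∑ l ∈ Finset.Ioc s t, ε l) :
    μ {ω | ∀ l ∈ Finset.Ioc s t, ε l = 1 → min 1 (c / ((l : ℝ) - s)) < U l ω} ≤
      ENNReal.ofReal (Real.exp (-(c / 2))) := by
  classical
  set A : Finset (Fin m) :=
    Finset.univ.filter fun i => (i : ℕ) + 1 ∈ Finset.Ioc s t ∧ ε ((i : ℕ) + 1) = 1 with hA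
  have hcard : A.card = ((Finset.Ioc s t).filter fun l => ε l = 1).card := by
    refine Finset.card_bij (fun i _ => (i : ℕ) + 1) ?_ ?_ ?_
    · intro i hi
      simpa [hA] using hi
    · intro i _ j _ h
      exact Fin.ext (by omega)
    · intro l hl
      have hl' := Finset.mem_filter.1 hl
      have hmem := Finset.mem_Ioc.1 hl'.1
      have hl1 : l - 1 + 1 = l := by omega
      exact ⟨⟨l - 1, by omega⟩, by
        rw [hA, Finset.mem_filter]
        exact ⟨Finset.mem_univ _, by rw [hl1]; exact hl'⟩, hl1⟩
  have hmajor : t - s < 2 * A.card := by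
    rw [hcard]
    simpa using card_lt_two_mul_card_filter_of_sum_pos (Finset.Ioc s t) ε
      (fun i hi => hε i (by simp at hi ⊢; omega)) hpos
  have hts : (0 : ℝ) < (t : ℝ) - s := sub_pos.2 (by exact_mod_cast hst)
  have hmajor' : (t : ℝ) - s ≤ 2 * A.card := by
    rw [← Nat.cast_sub hst.le]
    exact_mod_cast hmajor.le
  have hset : {ω | ∀ l ∈ Finset.Ioc s t, ε l = 1 → min 1 (c / ((l : ℝ) - s)) < U l ω} ⊆
      ⋂ i ∈ A, U ((i : ℕ) + 1) ⁻¹' Set.Ioi (min 1 (c / ((((i : ℕ) + 1 : ℕ) : ℝ) - s))) := by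
    intro ω hω
    simp only [Set.mem_iInter]
    intro i hi
    have hi' := (Finset.mem_filter.1 hi).2
    exact hω _ hi'.1 hi'.2
  calc _ ≤ _ := measure_mono hset
    _ = ∏ i ∈ A, μ (U ((i : ℕ) + 1) ⁻¹' Set.Ioi (min 1 (c / ((((i : ℕ) + 1 : ℕ) : ℝ) - s)))) :=
      hUindep.measure_inter_preimage_eq_mul A fun _ _ => measurableSet_Ioi
    _ ≤ ∏ _i ∈ A, ENNReal.ofReal (Real.exp (-(c / ((t : ℝ) - s)))) := by
      refine Finset.prod_le_prod' fun i hi => ?_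
      have hmem := Finset.mem_Ioc.1 (Finset.mem_filter.1 hi).2.1
      have hlow : (0 : ℝ) < (((i : ℕ) + 1 : ℕ) : ℝ) - s := sub_pos.2 (by exact_mod_cast hmem.1)
      have hup : (((i : ℕ) + 1 : ℕ) : ℝ) ≤ t := by exact_mod_cast hmem.2
      refine (measure_min_one_lt_le_exp (hUmeas _) (hUunif _ (by simp)) _).trans ?_
      apply ENNReal.ofReal_le_ofReal
      gcongr
    _ = ENNReal.ofReal (Real.exp (A.card * -(c / ((t : ℝ) - s)))) := by
      rw [Finset.prod_const, ← ENNReal.ofReal_pow (Real.exp_pos _).le, Real.exp_nat_mul]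
    _ ≤ ENNReal.ofReal (Real.exp (-(c / 2))) := by
      apply ENNReal.ofReal_le_ofReal
      apply Real.exp_le_exp.2
      have h : c / 2 ≤ A.card * (c / ((t : ℝ) - s)) := by
        rw [← mul_div_assoc, div_le_div_iff₀ two_pos hts]
        nlinarith
      linarith

/-- The process restarted after `s` misses all positive labels of some window with positive label
sum with probability at most `exp (-c / 2)`. -/
lemma measure_exists_window_missed_le (m : ℕ) (ε : ℕ → ℤ)
    (hε : ∀ i ∈ Finset.Icc 1 m, ε i = 1 ∨ ε i = -1) {c : ℝ} (hc : 0 ≤ c)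
    {Ω : Type*} [MeasurableSpace Ω] (μ : Measure Ω)
    (U : ℕ → Ω → ℝ) (hUmeas : ∀ i, Measurable (U i))
    (hUindep : iIndepFun (fun i : Fin m => U ((i : ℕ) + 1)) μ)
    (hUunif : ∀ i ∈ Finset.Icc 1 m, Measure.map (U i) μ = volume.restrict (Set.Icc (0 : ℝ) 1))
    (s : ℕ) :
    μ {ω | ∃ t ∈ Finset.Ioc s m, 0 < ∑ l ∈ Finset.Ioc s t, ε l ∧
        ∀ l ∈ Finset.Ioc s t, ε l = 1 → min 1 (c / ((l : ℝ) - s)) < U l ω} ≤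
      ENNReal.ofReal (Real.exp (-(c / 2))) := by
  classical
  by_cases hex : ∃ t, t ∈ Finset.Ioc s m ∧ 0 < ∑ l ∈ Finset.Ioc s t, ε l
  · obtain ⟨hmem, hpos⟩ := Nat.find_spec hex
    have hmem' := Finset.mem_Ioc.1 hmem
    refine (measure_mono ?_).trans (measure_window_missed_le m ε hε hc μ U hUmeas hUindep hUunif
      hmem'.1 hmem'.2 hpos)
    rintro ω ⟨t, ht, htpos, hmiss⟩ l hl
    exact hmiss l (Finset.Ioc_subset_Ioc_right (Nat.find_min' hex ⟨ht, htpos⟩) hl)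
  · refine (measure_mono (t := ∅) ?_).trans (by simp)
    rintro ω ⟨t, ht, htpos, -⟩
    exact hex ⟨t, ht, htpos⟩

/-- in the adaptive sampling process (W₁ = 1; S_i = 1 iff
U_i ≤ min(1, c/W_i); W_{i+1} = 1 if S_i = 1 and ε_i = +1, else W_i + 1), with
c = 2·ln(m/δ), if the number a of +1 labels exceeds 3 times the number b of −1
labels, then with probability at least 1 − δ there is an index i ≤ m at which
the number M⁺_i of sampled positives strictly exceeds i − M⁺_i. -/
theorem stmt_4 (m : ℕ) (hm : 1 ≤ m) (ε : ℕ → ℤ)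
    (hε : ∀ i ∈ Finset.Icc 1 m, ε i = 1 ∨ ε i = -1)
    (a b : ℕ)
    (ha : a = ((Finset.Icc 1 m).filter (fun i => ε i = 1)).card)
    (hb : b = ((Finset.Icc 1 m).filter (fun i => ε i = -1)).card)
    (δ : ℝ) (hδ0 : 0 < δ) (hδ1 : δ < 1)
    (c : ℝ) (hc : c = 2 * Real.log ((m : ℝ) / δ))
    {Ω : Type} [MeasurableSpace Ω] (μ : Measure Ω) [IsProbabilityMeasure μ]
    -- the independent uniform random variables U₁,…,U_m
    (U : ℕ → Ω → ℝ)
    (hUmeas : ∀ i, Measurable (U i))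
    (hUindep : iIndepFun (fun i : Fin m => U ((i : ℕ) + 1)) μ)
    (hUunif : ∀ i ∈ Finset.Icc 1 m, Measure.map (U i) μ = volume.restrict (Set.Icc (0 : ℝ) 1))
    -- the recursively defined weights and sampling indicators
    (W : ℕ → Ω → ℝ) (S : ℕ → Ω → Bool)
    (hW1 : ∀ ω, W 1 ω = 1)
    (hS : ∀ i ω, S i ω = true ↔ U i ω ≤ min 1 (c / W i ω))
    (hWsucc : ∀ i ω, W (i + 1) ω =
      if S i ω = true ∧ ε i = 1 then 1 else W i ω + 1)
    (hab : 3 * b < a) :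
    ENNReal.ofReal (1 - δ) ≤
      μ {ω | ∃ i ∈ Finset.Icc 1 m,
        i - ((Finset.Icc 1 i).filter (fun l => S l ω = true ∧ ε l = 1)).card <
          ((Finset.Icc 1 i).filter (fun l => S l ω = true ∧ ε l = 1)).card} := by
  have hm0 : (0 : ℝ) < m := by exact_mod_cast hm
  have hratio : 1 < (m : ℝ) / δ := by
    rw [one_lt_div hδ0]
    exact hδ1.trans_le (by exact_mod_cast hm)
  have hc0 : 0 ≤ c := by
    rw [hc]
    exact mul_nonneg two_pos.le (Real.log_nonneg hratio.le)
  have hexp : Real.exp (-(c / 2)) = δ / m := by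
    rw [hc, mul_div_cancel_left₀ _ two_ne_zero, Real.exp_neg, Real.exp_log (by linarith), inv_div]
  set bad : ℕ → Set Ω := fun s => {ω | ∃ t ∈ Finset.Ioc s m, 0 < ∑ l ∈ Finset.Ioc s t, ε l ∧
    ∀ l ∈ Finset.Ioc s t, ε l = 1 → min 1 (c / ((l : ℝ) - s)) < U l ω}
  set good : Set Ω := {ω | ∃ i ∈ Finset.Icc 1 m,
    i - ((Finset.Icc 1 i).filter (fun l => S l ω = true ∧ ε l = 1)).card <
      ((Finset.Icc 1 i).filter (fun l => S l ω = true ∧ ε l = 1)).card}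
  have hbad : μ (⋃ s ∈ Finset.range m, bad s) ≤ ENNReal.ofReal δ := by
    calc μ (⋃ s ∈ Finset.range m, bad s)
        ≤ ∑ s ∈ Finset.range m, μ (bad s) := measure_biUnion_finset_le _ _
      _ ≤ ∑ _s ∈ Finset.range m, ENNReal.ofReal (δ / m) := Finset.sum_le_sum fun s _ => hexp ▸
        measure_exists_window_missed_le m ε hε hc0 μ U hUmeas hUindep hUunif s
      _ = ENNReal.ofReal δ := by
        rw [Finset.sum_const, Finset.card_range, ← ENNReal.ofReal_nsmul, nsmul_eq_mul,
          mul_div_cancel₀ _ hm0.ne']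
  have hcover : Set.univ ⊆ good ∪ ⋃ s ∈ Finset.range m, bad s := by
    intro ω _
    by_contra hω
    simp only [Set.mem_union, Set.mem_iUnion, not_or, not_exists] at hω
    obtain ⟨hnotgood, hnotbad⟩ := hω
    have hsum := sum_unsampled_nonpos m ε c (U · ω) (W · ω) (S · ω) (hW1 ω) (hS · ω)
      (hWsucc · ω) (by
        intro s hs t ht hpos
        by_contra! hmiss
        exact hnotbad s (Finset.mem_range.2 hs) ⟨t, ht, hpos, hmiss⟩)
    apply hnotgood
    refine ⟨m, by simp [hm], ?_⟩
    have hIoc : Finset.Ioc 0 m = Finset.Icc 1 m := rfl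
    have hsplit : ∑ l ∈ Finset.Icc 1 m, (if S l ω = true ∧ ε l = 1 then 0 else ε l) =
        ∑ l ∈ Finset.Icc 1 m, ((if ε l = 1 then 1 else 0) - (if ε l = -1 then 1 else 0) -
          (if S l ω = true ∧ ε l = 1 then 1 else 0) : ℤ) := by
      refine Finset.sum_congr rfl fun l hl => ?_
      rcases hε l hl with h | h <;> by_cases hs : S l ω = true <;> simp [h, hs]
    have htotal : ∑ l ∈ Finset.Icc 1 m, ((if ε l = 1 then 1 else 0) +
        (if ε l = -1 then 1 else 0) : ℤ) = ∑ l ∈ Finset.Icc 1 m, (1 : ℤ) := by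
      refine Finset.sum_congr rfl fun l hl => ?_
      rcases hε l hl with h | h <;> simp [h]
    rw [hIoc, hsplit, Finset.sum_sub_distrib, Finset.sum_sub_distrib] at hsum
    rw [Finset.sum_add_distrib] at htotal
    simp only [Finset.sum_boole, ← ha, ← hb] at hsum htotal
    simp at htotal
    omega
  have hone : 1 ≤ μ good + ENNReal.ofReal δ := by
    calc (1 : ENNReal) = μ Set.univ := measure_univ.symm
      _ ≤ _ := measure_mono hcover
      _ ≤ _ := measure_union_le _ _
      _ ≤ _ := by gcongr
  rw [ENNReal.ofReal_sub _ hδ0.le, ENNReal.ofReal_one]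
  exact tsub_le_iff_right.2 hone
end

section
/- For every real c > 0 and integer m ≥ 1, the expected total number of sampled points satisfies E[Σ_{i=1}^m S_i] ≤ (a + 1)·c·(1 + ln m), where a = |{i : ε_i = +1}| is the number of positive labels. -/
open MeasureTheory ProbabilityTheory

/-- If `V` is uniform on `[0, 1]` and independent of `X`, then `V ≤ f X` has probability at most
the mean of `f X`. -/
lemma measure_le_comp_le_lintegral {Ω : Type*} [MeasurableSpace Ω] {μ : Measure Ω}
    [IsProbabilityMeasure μ] {X V : Ω → ℝ} (hX : Measurable X) (hV : Measurable V)
    (hXV : IndepFun X V μ) (hunif : Measure.map V μ = volume.restrict (Set.Icc (0 : ℝ) 1))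
    {f : ℝ → ℝ} (hf : Measurable f) :
    μ {ω | V ω ≤ f (X ω)} ≤ ∫⁻ ω, ENNReal.ofReal (f (X ω)) ∂μ := by
  have hmeas : MeasurableSet {p : ℝ × ℝ | p.2 ≤ f p.1} :=
    measurableSet_le measurable_snd (hf.comp measurable_fst)
  have hprod := (indepFun_iff_map_prod_eq_prod_map_map hX.aemeasurable hV.aemeasurable).1 hXV
  have : IsProbabilityMeasure (μ.map V) := Measure.isProbabilityMeasure_map hV.aemeasurable
  calc μ {ω | V ω ≤ f (X ω)}
      = μ.map (fun ω => (X ω, V ω)) {p : ℝ × ℝ | p.2 ≤ f p.1} :=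
        (Measure.map_apply (hX.prodMk hV) hmeas).symm
    _ = ∫⁻ x, μ.map V (Set.Iic (f x)) ∂(μ.map X) := by
        rw [hprod, Measure.prod_apply hmeas]; rfl
    _ ≤ ∫⁻ x, ENNReal.ofReal (f x) ∂(μ.map X) := by
        refine lintegral_mono fun x => ?_
        have hsub : Set.Iic (f x) ∩ Set.Icc (0 : ℝ) 1 ⊆ Set.Icc 0 (f x) :=
          fun u hu => ⟨hu.2.1, hu.1⟩
        rw [hunif, Measure.restrict_apply measurableSet_Iic]
        simpa using measure_mono (μ := volume) hsub
    _ = ∫⁻ ω, ENNReal.ofReal (f (X ω)) ∂μ :=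
        lintegral_map (ENNReal.measurable_ofReal.comp hf) hX

lemma monotone_harmonic : Monotone harmonic :=
  monotone_nat_of_le_succ fun n => by
    rw [harmonic_succ]
    exact le_add_of_nonneg_right (by positivity)

/-- A counter that starts at `1` and at each step either increases by `1` or, at the indices in
`P` only, may be reset to `1`, has natural values, and its reciprocals sum to at most one harmonic
sum per index in `P`, plus a last one. -/
lemma sum_inv_le_of_reset (m : ℕ) (P : ℕ → Prop) [DecidablePred P] (w : ℕ → ℝ) (hw1 : w 1 = 1)
    (hw : ∀ i, (P i ∧ w (i + 1) = 1) ∨ w (i + 1) = w i + 1) (k : ℕ) (hk : k + 1 ≤ m) :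
    ∃ n : ℕ, w (k + 1) = n ∧ 1 ≤ n ∧ n ≤ k + 1 ∧
      ∑ i ∈ Finset.Icc 1 (k + 1), (w i)⁻¹ ≤
        ((Finset.Icc 1 k).filter P).card * (harmonic m : ℝ) + (harmonic n : ℝ) := by
  induction k with
  | zero => exact ⟨1, by simp [hw1, harmonic]⟩
  | succ k ih =>
    obtain ⟨n, hn, h1, hle, hsum⟩ := ih (by omega)
    have hmono : (harmonic n : ℝ) ≤ harmonic m := by exact_mod_cast monotone_harmonic (by omega)
    have hm0 : (0 : ℝ) ≤ harmonic m := by exact_mod_cast (harmonic_pos (by omega)).le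
    rw [Finset.sum_Icc_succ_top (by omega)]
    rcases hw (k + 1) with ⟨hP, h⟩ | h
    · refine ⟨1, by simp [h], le_rfl, by omega, ?_⟩
      have hcard : ((Finset.Icc 1 (k + 1)).filter P).card =
          ((Finset.Icc 1 k).filter P).card + 1 := by
        rw [← Finset.insert_Icc_right_eq_Icc_add_one (by omega), Finset.filter_insert, if_pos hP,
          Finset.card_insert_of_notMem (by simp)]
      rw [hcard, h]
      simp only [harmonic_succ, harmonic_zero]
      push_cast
      norm_num
      linarith
    · refine ⟨n + 1, by rw [h, hn]; push_cast; ring, by omega, by omega, ?_⟩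
      have hcard : (((Finset.Icc 1 k).filter P).card : ℝ) ≤
          ((Finset.Icc 1 (k + 1)).filter P).card := by
        exact_mod_cast Finset.card_le_card
          (Finset.filter_subset_filter _ (Finset.Icc_subset_Icc_right (by omega)))
      rw [h, hn, harmonic_succ]
      push_cast
      nlinarith [mul_le_mul_of_nonneg_right hcard hm0]

/-- in the adaptive sampling process (W₁ = 1; S_i = 1 iff
U_i ≤ min(1, c/W_i); W_{i+1} = 1 if S_i = 1 and ε_i = +1, else W_i + 1), for every
real c > 0 and integer m ≥ 1 the expected total number of sampled points is at most
(a + 1)·c·(1 + ln m), where a is the number of +1 labels. -/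
theorem stmt_5 (m : ℕ) (hm : 1 ≤ m) (ε : ℕ → ℤ)
    (hε : ∀ i ∈ Finset.Icc 1 m, ε i = 1 ∨ ε i = -1)
    (a : ℕ)
    (ha : a = ((Finset.Icc 1 m).filter (fun i => ε i = 1)).card)
    (c : ℝ) (hc : 0 < c)
    {Ω : Type} [MeasurableSpace Ω] (μ : Measure Ω) [IsProbabilityMeasure μ]
    -- the independent uniform random variables U₁,…,U_m
    (U : ℕ → Ω → ℝ)
    (hUmeas : ∀ i, Measurable (U i))
    (hUindep : iIndepFun (fun i : Fin m => U ((i : ℕ) + 1)) μ)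
    (hUunif : ∀ i ∈ Finset.Icc 1 m, Measure.map (U i) μ = volume.restrict (Set.Icc (0 : ℝ) 1))
    -- the recursively defined weights and sampling indicators
    (W : ℕ → Ω → ℝ) (S : ℕ → Ω → Bool)
    (hW1 : ∀ ω, W 1 ω = 1)
    (hS : ∀ i ω, S i ω = true ↔ U i ω ≤ min 1 (c / W i ω))
    (hWsucc : ∀ i ω, W (i + 1) ω =
      if S i ω = true ∧ ε i = 1 then 1 else W i ω + 1) :
    ∫ ω, ((((Finset.Icc 1 m).filter (fun l => S l ω = true)).card : ℝ)) ∂μ ≤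
      ((a : ℝ) + 1) * c * (1 + Real.log (m : ℝ)) := by
  classical
  -- the σ-algebra generated by the first `k` uniform variables
  let F : ℕ → MeasurableSpace Ω := fun k =>
    ⨆ j ∈ {j : Fin m | (j : ℕ) < k}, MeasurableSpace.comap (U ((j : ℕ) + 1)) inferInstance
  have hFmono : ∀ k, F k ≤ F (k + 1) := fun k =>
    biSup_mono fun j (hj : (j : ℕ) < k) => Nat.lt_succ_of_lt hj
  have hFle : ∀ k, F k ≤ ‹MeasurableSpace Ω› := fun k =>
    iSup₂_le fun j _ => (hUmeas _).comap_le
  have hUF : ∀ k < m, Measurable[F (k + 1)] (U (k + 1)) := fun k hk =>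
    measurable_iff_comap_le.2 (le_iSup₂_of_le (⟨k, hk⟩ : Fin m) (Nat.lt_succ_self k) le_rfl)
  have hWF : ∀ k, k ≤ m → Measurable[F k] (W (k + 1)) := by
    intro k
    induction k with
    | zero =>
      intro _
      have : W (0 + 1) = fun _ => 1 := funext hW1
      rw [this]
      exact measurable_const
    | succ k ih =>
      intro hk
      have hWk : Measurable[F (k + 1)] (W (k + 1)) := (ih (by omega)).mono (hFmono k) le_rfl
      have hset : MeasurableSet[F (k + 1)] {ω | S (k + 1) ω = true ∧ ε (k + 1) = 1} := by
        have heq : {ω | S (k + 1) ω = true ∧ ε (k + 1) = 1} =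
            {ω | U (k + 1) ω ≤ min 1 (c / W (k + 1) ω)} ∩ {_ω | ε (k + 1) = 1} := by
          ext ω
          simp [hS]
        rw [heq]
        exact (measurableSet_le (hUF k hk)
          (measurable_const.min (measurable_const.div hWk))).inter (MeasurableSet.const _)
      rw [show W (k + 1 + 1) = _ from funext (hWsucc (k + 1))]
      exact Measurable.ite hset measurable_const (hWk.add_const 1)
  have hindep : ∀ k < m, IndepFun (W (k + 1)) (U (k + 1)) μ := by
    intro k hk
    have hdisj : Disjoint {j : Fin m | (j : ℕ) < k} {(⟨k, hk⟩ : Fin m)} := by simp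
    have h := indep_iSup_of_disjoint (fun j => (hUmeas _).comap_le) hUindep.iIndep hdisj
    rw [iSup_singleton] at h
    exact indep_of_indep_of_le_left h (hWF k hk.le).comap_le
  have hWmeas : ∀ i ∈ Finset.Icc 1 m, Measurable (W i) := by
    intro i hi
    obtain ⟨k, rfl⟩ := Nat.exists_eq_add_of_le' (Finset.mem_Icc.1 hi).1
    exact (hWF k (by have := (Finset.mem_Icc.1 hi).2; omega)).mono (hFle k) le_rfl
  have hreset : ∀ ω i, (ε i = 1 ∧ W (i + 1) ω = 1) ∨ W (i + 1) ω = W i ω + 1 := by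
    intro ω i
    rw [hWsucc]
    split_ifs with h
    · exact Or.inl ⟨h.2, rfl⟩
    · exact Or.inr rfl
  have hW_one_le : ∀ i ∈ Finset.Icc 1 m, ∀ ω, 1 ≤ W i ω := by
    intro i hi ω
    obtain ⟨k, rfl⟩ := Nat.exists_eq_add_of_le' (Finset.mem_Icc.1 hi).1
    obtain ⟨n, hn, h1, -⟩ := sum_inv_le_of_reset m (fun i => ε i = 1) (fun i => W i ω) (hW1 ω)
      (hreset ω) k (Finset.mem_Icc.1 hi).2
    rw [hn]
    exact_mod_cast h1
  have hint : ∀ i ∈ Finset.Icc 1 m, Integrable (fun ω => c / W i ω) μ := by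
    intro i hi
    refine Integrable.of_bound (measurable_const.div (hWmeas i hi)).aestronglyMeasurable c
      (Filter.Eventually.of_forall fun ω => ?_)
    have h1 := hW_one_le i hi ω
    rw [Real.norm_of_nonneg (by positivity)]
    exact div_le_self hc.le h1
  have hSmeas : ∀ i ∈ Finset.Icc 1 m, MeasurableSet {ω | S i ω = true} := by
    intro i hi
    simp only [hS]
    exact measurableSet_le (hUmeas i)
      (measurable_const.min (measurable_const.div (hWmeas i hi)))
  have hprob : ∀ i ∈ Finset.Icc 1 m, μ.real {ω | S i ω = true} ≤ ∫ ω, c / W i ω ∂μ := by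
    intro i hi
    have hnonneg : ∀ ω, 0 ≤ c / W i ω := fun ω => by
      have := hW_one_le i hi ω
      positivity
    refine ENNReal.toReal_le_of_le_ofReal (integral_nonneg hnonneg) ?_
    rw [ofReal_integral_eq_lintegral_ofReal (hint i hi) (Filter.Eventually.of_forall hnonneg)]
    have hWU : IndepFun (W i) (U i) μ := by
      obtain ⟨k, rfl⟩ := Nat.exists_eq_add_of_le' (Finset.mem_Icc.1 hi).1
      exact hindep k (Finset.mem_Icc.1 hi).2
    exact (measure_mono fun ω hω => ((hS i ω).1 hω).trans (min_le_right _ _)).trans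
      (measure_le_comp_le_lintegral (f := fun w => c / w) (hWmeas i hi) (hUmeas i) hWU
        (hUunif i hi) (measurable_const.div measurable_id))
  have hpath : ∀ ω, ∑ i ∈ Finset.Icc 1 m, c / W i ω ≤
      ((a : ℝ) + 1) * c * (1 + Real.log (m : ℝ)) := by
    intro ω
    obtain ⟨k, rfl⟩ := Nat.exists_eq_add_of_le' hm
    obtain ⟨n, -, -, hn, hsum⟩ := sum_inv_le_of_reset (k + 1) (fun i => ε i = 1)
      (fun i => W i ω) (hW1 ω) (hreset ω) k le_rfl
    have hmono : (harmonic n : ℝ) ≤ harmonic (k + 1) := by exact_mod_cast monotone_harmonic hn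
    have hm0 : (0 : ℝ) ≤ harmonic (k + 1) := by
      exact_mod_cast (harmonic_pos (Nat.succ_ne_zero k)).le
    have hcard : (((Finset.Icc 1 k).filter (fun i => ε i = 1)).card : ℝ) ≤ a := by
      rw [ha]
      exact_mod_cast Finset.card_le_card
        (Finset.filter_subset_filter _ (Finset.Icc_subset_Icc_right (by omega)))
    simp only [div_eq_mul_inv]
    rw [← Finset.mul_sum]
    calc c * ∑ i ∈ Finset.Icc 1 (k + 1), (W i ω)⁻¹
        ≤ c * ((a + 1) * harmonic (k + 1)) := by
          refine mul_le_mul_of_nonneg_left ?_ hc.le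
          nlinarith [mul_le_mul_of_nonneg_right hcard hm0]
      _ = (a + 1) * c * harmonic (k + 1) := by ring
      _ ≤ _ := by
          gcongr
          exact harmonic_le_one_add_log (k + 1)
  have hcount : ∀ ω, (((Finset.Icc 1 m).filter (fun l => S l ω = true)).card : ℝ) =
      ∑ i ∈ Finset.Icc 1 m, Set.indicator {ω | S i ω = true} (fun _ => (1 : ℝ)) ω := by
    intro ω
    simp [Set.indicator_apply]
  calc ∫ ω, (((Finset.Icc 1 m).filter (fun l => S l ω = true)).card : ℝ) ∂μ
      = ∑ i ∈ Finset.Icc 1 m, μ.real {ω | S i ω = true} := by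
        simp_rw [hcount]
        rw [integral_finsetSum _ fun i hi => (integrable_const 1).indicator (hSmeas i hi)]
        refine Finset.sum_congr rfl fun i hi => ?_
        rw [integral_indicator_const _ (hSmeas i hi)]
        simp
    _ ≤ ∑ i ∈ Finset.Icc 1 m, ∫ ω, c / W i ω ∂μ := Finset.sum_le_sum hprob
    _ = ∫ ω, ∑ i ∈ Finset.Icc 1 m, c / W i ω ∂μ := (integral_finsetSum _ hint).symm
    _ ≤ ∫ _, ((a : ℝ) + 1) * c * (1 + Real.log (m : ℝ)) ∂μ :=
        integral_mono (integrable_finsetSum _ hint) (integrable_const _) hpath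
    _ = ((a : ℝ) + 1) * c * (1 + Real.log (m : ℝ)) := by simp
end
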